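/- Let F be a field of prime characteristic p containing a subfield with p^n elements, n ≥ 1, and suppose q(X) = X^{p^n} − X − a ∈ F[X] is irreducible. Let K = F[α] be the splitting field of q over F, where α is a root of q, and let G = Gal(K/F). Let H be a subgroup of G of order p^m (0 ≤ m ≤ n), and set α_H = ∏_{σ∈H} σ(α). Then the fixed field K^H of H equals F[α_H]; in particular, α_H is a primitive element for the intermediate field K^H over F. -/

import Mathlib

open Polynomial

/-- In an extension `K` of a field `F` containing a subfield with `q` elements, every solution of
`x ^ q = x` already lies in `F`. -/
lemma mem_range_algebraMap_of_pow_card_eq {F K : Type*} [Field F] [Field K] [Algebra F K]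
    (E : Subfield F) [Finite E] {x : K} (hx : x ^ Nat.card E = x) :
    x ∈ Set.range (algebraMap F K) := by
  classical
  have := Fintype.ofFinite E
  rw [Nat.card_eq_fintype_card] at hx
  have hq : 1 < Fintype.card E := Fintype.one_lt_card
  have hne := FiniteField.X_pow_card_sub_X_ne_zero K hq
  let S : Finset K := Finset.univ.image (algebraMap E K)
  have hScard : S.card = Fintype.card E :=
    Finset.card_image_of_injective _ (algebraMap E K).injective
  have hS : S = (X ^ Fintype.card E - X : K[X]).roots.toFinset := by
    refine Finset.eq_of_subset_of_card_le (fun y hy ↦ ?_) ?_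
    · obtain ⟨c, -, rfl⟩ := Finset.mem_image.mp hy
      rw [Multiset.mem_toFinset, mem_roots hne]
      simp [← map_pow, FiniteField.pow_card]
    · rw [hScard]
      exact (Multiset.toFinset_card_le _).trans ((card_roots' _).trans
        (FiniteField.X_pow_card_sub_X_natDegree_eq K hq).le)
  have hxS : x ∈ S := by
    rw [hS, Multiset.mem_toFinset, mem_roots hne]
    simp [hx]
  obtain ⟨c, -, rfl⟩ := Finset.mem_image.mp hxS
  exact ⟨c, rfl⟩

/-- If `α` generates `K` over `F` and is a root of a monic polynomial `f` over the intermediate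
field `L`, then `[K : L] ≤ deg f`. -/
lemma finrank_le_natDegree_of_adjoin_eq_top {F K : Type*} [Field F] [Field K] [Algebra F K]
    {α : K} (hα : IntermediateField.adjoin F {α} = ⊤) (L : IntermediateField F K)
    {f : L[X]} (hf : f.Monic) (hroot : aeval α f = 0) :
    Module.finrank L K ≤ f.natDegree := by
  have htop : IntermediateField.adjoin L {α} = ⊤ := by
    rw [← IntermediateField.restrictScalars_eq_top_iff (K := F),
      IntermediateField.restrictScalars_adjoin, eq_top_iff, ← hα]
    exact IntermediateField.adjoin.mono _ _ _ Set.subset_union_right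
  rw [← IntermediateField.finrank_top', ← htop,
    IntermediateField.adjoin.finrank ⟨f, hf, hroot⟩]
  exact natDegree_le_of_dvd (minpoly.dvd L α hroot) hf.ne_zero

/-- If every element of `H` translates the generator `α` by an element of `F`, then the fixed
field of `H` is generated by the product of the conjugates of `α` under `H`. -/
lemma fixedField_eq_adjoin_prod {F K : Type*} [Field F] [Field K] [Algebra F K]
    [FiniteDimensional F K] {α : K} (hα : IntermediateField.adjoin F {α} = ⊤)
    (H : Subgroup (K ≃ₐ[F] K)) [Fintype H] (e : H → F)
    (he : ∀ σ : H, (σ : K ≃ₐ[F] K) α = α + algebraMap F K (e σ)) :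
    IntermediateField.fixedField H =
      IntermediateField.adjoin F {∏ σ : H, (σ : K ≃ₐ[F] K) α} := by
  set β := ∏ σ : H, (σ : K ≃ₐ[F] K) α with hβ
  set L := IntermediateField.adjoin F {β}
  have hle : L ≤ IntermediateField.fixedField H := by
    rw [IntermediateField.adjoin_simple_le_iff, IntermediateField.mem_fixedField_iff]
    intro τ hτ
    rw [hβ, map_prod]
    exact Fintype.prod_equiv (Equiv.mulLeft (⟨τ, hτ⟩ : H)) _ _ fun σ ↦ rfl
  refine (IntermediateField.eq_of_le_of_finrank_le' hle ?_).symm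
  let b : L := ⟨β, IntermediateField.mem_adjoin_simple_self F β⟩
  let g : L[X] := ∏ σ : H, (X + C (algebraMap F L (e σ)))
  have hg : g.Monic := monic_prod_of_monic _ _ fun σ _ ↦ monic_X_add_C _
  have hgdeg : g.natDegree = Fintype.card H := by
    rw [natDegree_prod_of_monic _ _ fun σ _ ↦ monic_X_add_C _]
    simp
  have hpos : 0 < g.natDegree := hgdeg ▸ Fintype.card_pos
  have hroot : aeval α (g - C b) = 0 := by
    simp only [g, map_sub, map_prod, map_add, aeval_X, aeval_C,
      ← IsScalarTower.algebraMap_apply, ← he]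
    exact sub_self β
  refine (finrank_le_natDegree_of_adjoin_eq_top hα L
    (hg.sub_of_left (degree_C_le.trans_lt (natDegree_pos_iff_degree_pos.mp hpos))) hroot).trans ?_
  rw [IntermediateField.finrank_fixedField_eq_card, Nat.card_eq_fintype_card, natDegree_sub_C,
    hgdeg]


open Polynomial

/-- Let `F` have prime characteristic `p` and contain a subfield with `p^n` elements,
`n ≥ 1`, and suppose `q(X) = X^{p^n} - X - a ∈ F[X]` is irreducible.  Let `K = F[α]` where
`α` is a root of `q`, and let `G = Gal(K/F)`.  If `H ≤ G` is a subgroup of order `p^m`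
(`0 ≤ m ≤ n`) and `α_H = ∏_{σ ∈ H} σ(α)`, then the fixed field `K^H` equals `F[α_H]`;
in particular `α_H` is a primitive element of the intermediate field `K^H` over `F`. -/
theorem stmt15 {F K : Type*} [Field F] [Field K] [Algebra F K]
    (p : ℕ) [Fact p.Prime] [CharP F p]
    (n : ℕ) (hn : 1 ≤ n) (hE : ∃ E : Subfield F, Nat.card E = p ^ n) (a : F)
    (hirr : Irreducible (X ^ p ^ n - X - C a : Polynomial F))
    (α : K) (hα : (Polynomial.aeval α) (X ^ p ^ n - X - C a : Polynomial F) = 0)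
    (hgen : Algebra.adjoin F {α} = ⊤)
    (H : Subgroup (K ≃ₐ[F] K)) [Fintype H] (m : ℕ) (hm : m ≤ n)
    (hH : Fintype.card H = p ^ m) :
    IntermediateField.fixedField H =
      IntermediateField.adjoin F {∏ σ : H, (σ : K ≃ₐ[F] K) α} := by
  obtain ⟨E, hE⟩ := hE
  have : Finite E := Nat.finite_of_card_ne_zero
    (hE ▸ pow_ne_zero n (Fact.out : p.Prime).ne_zero)
  have : CharP K p := charP_of_injective_algebraMap (algebraMap F K).injective p
  have hαint : IsIntegral F α := IsAlgebraic.isIntegral ⟨_, hirr.ne_zero, hα⟩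
  have htop : IntermediateField.adjoin F {α} = ⊤ := by
    rw [← IntermediateField.toSubalgebra_injective.eq_iff,
      IntermediateField.adjoin_simple_toSubalgebra_of_isAlgebraic hαint.isAlgebraic, hgen,
      IntermediateField.top_toSubalgebra]
  have : FiniteDimensional F K := by
    have := IntermediateField.adjoin.finiteDimensional hαint
    rw [htop] at this
    exact IntermediateField.topEquiv.toLinearEquiv.finiteDimensional
  have hroot : α ^ p ^ n = α + algebraMap F K a := by
    simp only [map_sub, map_pow, aeval_X, aeval_C] at hα
    linear_combination hα
  have hconj (σ : H) :
      (σ : K ≃ₐ[F] K) α - α ∈ Set.range (algebraMap F K) := by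
    apply mem_range_algebraMap_of_pow_card_eq E
    rw [hE, sub_pow_char_pow, ← map_pow, hroot, map_add, AlgEquiv.commutes]
    ring
  choose e he using hconj
  exact fixedField_eq_adjoin_prod htop H e fun σ ↦ by rw [he]; ring
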